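/- arXiv:2302.07937 — 2 statements merged into one kernel-verified Lean document; each statement's English description precedes it below -/
import Mathlib

section
/- For every a > 0 there exist constants C > 0 and d_0 ∈ ℕ such that the following holds for every d ≥ d_0, every l ≤ d^a, and every p with C·√(log d / d) ≤ p ≤ 1. Let W_1, …, W_{2l} (W_i ∈ ℝ^{d²×d} for odd i, W_i ∈ ℝ^{d×d²} for even i) have entries drawn i.i.d. from a probability distribution on ℝ that is absolutely continuous with respect to Lebesgue measure, and let M_1, …, M_{2l} be random {0,1}-matrices of matching shapes with entries i.i.d. Bernoulli(p), independent of the W_i. Then with probability at least 1 − 1/d the following event occurs: for every target ReLU network g(x) = Γ*_l V_l σ(⋯ σ(Γ*_1 V_1 x + β*_1) ⋯) + β*_l with V_i ∈ ℝ^{d×d}, ‖V_i‖ ≤ 1, Γ*_i diagonal and β*_i ∈ ℝ^d, there exist diagonal matrices Γ_1, …, Γ_{2l} and vectors β_1, …, β_{2l} such that the network f(x) = Γ_{2l} (W_{2l}∘M_{2l}) σ( ⋯ σ( Γ_1 (W_1∘M_1) x + β_1 ) ⋯ ) + β_{2l} satisfies f(x) = g(x) for every x ∈ ℝ^d with ‖x‖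 ≤ 1. -/
noncomputable section
open MeasureTheory Matrix ENNReal

/-- The ReLU activation `σ(t) = max(t, 0)`. -/
def relu (t : ℝ) : ℝ := max t 0

/-- Entrywise ReLU on a vector. -/
def reluV {n : ℕ} (v : Fin n → ℝ) : Fin n → ℝ := fun i => relu (v i)

/-- Euclidean norm of a vector. -/
def eNorm {n : ℕ} (v : Fin n → ℝ) : ℝ := Real.sqrt (∑ i, v i ^ 2)

/-- Frobenius norm of a matrix. -/
def frob {n m : ℕ} (A : Matrix (Fin n) (Fin m) ℝ) : ℝ := Real.sqrt (∑ i, ∑ j, A i j ^ 2)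

/-- Iterated composition: `chain step k = step (k-1) ∘ ⋯ ∘ step 0`. -/
def chain {α : Type*} (step : ℕ → α → α) : ℕ → α → α
  | 0 => fun x => x
  | k + 1 => fun x => step k (chain step k x)

/-- Extend a `Fin l`-indexed family to a `ℕ`-indexed one (by `0` out of range). -/
def ext {l : ℕ} {α : Type*} [Zero α] (f : Fin l → α) : ℕ → α :=
  fun k => if h : k < l then f ⟨k, h⟩ else 0

/-- One affine layer `y ↦ Γ V y + β` of the target network (`Γ` diagonal). -/
def gLayer {d : ℕ} (Γ : Fin d → ℝ) (V : Matrix (Fin d) (Fin d) ℝ) (β : Fin d → ℝ)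
    (y : Fin d → ℝ) : Fin d → ℝ :=
  diagonal Γ *ᵥ (V *ᵥ y) + β

/-- The target network
`g(x) = Γ*_l V_l σ(⋯ σ(Γ*_1 V_1 x + β*_1) ⋯) + β*_l`. -/
def gNet (d l : ℕ) (Γ : ℕ → Fin d → ℝ) (V : ℕ → Matrix (Fin d) (Fin d) ℝ)
    (β : ℕ → Fin d → ℝ) (x : Fin d → ℝ) : Fin d → ℝ :=
  gLayer (Γ (l - 1)) (V (l - 1)) (β (l - 1))
    (chain (fun k y => reluV (gLayer (Γ k) (V k) (β k) y)) (l - 1) x)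

/-- A pair of consecutive layers of the random network: `y ↦ Γe We σ(Γo Wo y + βo) + βe`. -/
def fBlock {d : ℕ} (Γo βo : Fin (d * d) → ℝ) (Γe βe : Fin d → ℝ)
    (Wo : Matrix (Fin (d * d)) (Fin d) ℝ) (We : Matrix (Fin d) (Fin (d * d)) ℝ)
    (y : Fin d → ℝ) : Fin d → ℝ :=
  diagonal Γe *ᵥ (We *ᵥ reluV (diagonal Γo *ᵥ (Wo *ᵥ y) + βo)) + βe

/-- The `2l`-layer random network with ReLUs after every layer but the last. -/
def fNet (d l : ℕ) (Γo βo : ℕ → Fin (d * d) → ℝ) (Γe βe : ℕ → Fin d → ℝ)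
    (Wo : ℕ → Matrix (Fin (d * d)) (Fin d) ℝ) (We : ℕ → Matrix (Fin d) (Fin (d * d)) ℝ)
    (x : Fin d → ℝ) : Fin d → ℝ :=
  fBlock (Γo (l - 1)) (βo (l - 1)) (Γe (l - 1)) (βe (l - 1)) (Wo (l - 1)) (We (l - 1))
    (chain (fun k y => reluV (fBlock (Γo k) (βo k) (Γe k) (βe k) (Wo k) (We k) y)) (l - 1) x)

/-- The Bernoulli(p) measure on `ℝ`: mass `p` at `1` and mass `1 − p` at `0`. -/
def bern (p : ℝ) : Measure ℝ :=
  ENNReal.ofReal p • Measure.dirac (1 : ℝ) + ENNReal.ofReal (1 - p) • Measure.dirac (0 : ℝ)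

/-- The joint law of the random weights `(W_odd, W_even)` (entries i.i.d. `ν`) and of the
Bernoulli(p) masks `(M_odd, M_even)`, all mutually independent. -/
def jointLaw (d l : ℕ) (ν : Measure ℝ) (p : ℝ) :
    Measure ((Fin l → Fin (d * d) → Fin d → ℝ) × (Fin l → Fin d → Fin (d * d) → ℝ) ×
             (Fin l → Fin (d * d) → Fin d → ℝ) × (Fin l → Fin d → Fin (d * d) → ℝ)) :=
  (Measure.pi fun _ => Measure.pi fun _ => Measure.pi fun _ => ν).prod
    ((Measure.pi fun _ => Measure.pi fun _ => Measure.pi fun _ => ν).prod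
      ((Measure.pi fun _ => Measure.pi fun _ => Measure.pi fun _ => bern p).prod
        (Measure.pi fun _ => Measure.pi fun _ => Measure.pi fun _ => bern p)))

theorem ae_eval_ne_zero_fin (μ : Measure ℝ) [IsProbabilityMeasure μ] [NullSingletonClass μ] {n : ℕ}
    (P : MvPolynomial (Fin n) ℝ) (hP : P ≠ 0) :
    ∀ᵐ x ∂Measure.pi fun _ : Fin n => μ, MvPolynomial.eval x P ≠ 0 := by
  induction n with
  | zero =>
    refine Filter.Eventually.of_forall fun x h => hP ?_
    obtain ⟨c, rfl⟩ := MvPolynomial.C_surjective (Fin 0) P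
    simp_all
  | succ n ih =>
    have hQ : MvPolynomial.finSuccEquiv ℝ n P ≠ 0 := by simpa using hP
    have hL := ih _ (Polynomial.leadingCoeff_ne_zero.2 hQ)
    have hmp := (measurePreserving_piFinSuccAbove (fun _ : Fin (n + 1) => μ) 0).symm
    have hmeas : MeasurableSet {x : Fin (n + 1) → ℝ | MvPolynomial.eval x P = 0} :=
      (isClosed_singleton.preimage (MvPolynomial.continuous_eval P)).measurableSet
    have h0 : (μ.prod (Measure.pi fun _ : Fin n => μ))
        ((MeasurableEquiv.piFinSuccAbove (fun _ : Fin (n + 1) => ℝ) 0).symm ⁻¹'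
          {x | MvPolynomial.eval x P = 0}) = 0 := by
      rw [Measure.prod_apply_symm (hmp.measurable hmeas), lintegral_eq_zero_iff
        (measurable_measure_prodMk_right (hmp.measurable hmeas))]
      filter_upwards [hL] with s hs
      have hR : Polynomial.map (MvPolynomial.eval s) (MvPolynomial.finSuccEquiv ℝ n P) ≠ 0 := by
        intro h
        apply hs
        have := congrArg (fun q => Polynomial.coeff q (MvPolynomial.finSuccEquiv ℝ n P).natDegree) h
        simpa [Polynomial.coeff_map] using this
      refine Set.Countable.measure_zero (Set.Finite.countable ?_) μ
      refine (Polynomial.map (MvPolynomial.eval s)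
        (MvPolynomial.finSuccEquiv ℝ n P)).roots.toFinset.finite_toSet.subset fun y hy => ?_
      have hy' : MvPolynomial.eval (Fin.cons y s : Fin (n + 1) → ℝ) P = 0 := by
        simpa [MeasurableEquiv.piFinSuccAbove_symm_apply, Fin.insertNthEquiv] using hy
      rw [MvPolynomial.eval_eq_eval_mv_eval'] at hy'
      simpa [hR] using hy'
    rw [hmp.measure_preimage hmeas.nullMeasurableSet] at h0
    rw [ae_iff]
    simpa using h0

theorem ae_eval_ne_zero {ι : Type*} [Fintype ι] (μ : Measure ℝ) [IsProbabilityMeasure μ]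
    [NullSingletonClass μ] (P : MvPolynomial ι ℝ) (hP : P ≠ 0) :
    ∀ᵐ x ∂Measure.pi fun _ : ι => μ, MvPolynomial.eval x P ≠ 0 := by
  let e := Fintype.equivFin ι
  have hmp := measurePreserving_piCongrLeft (α := fun _ => ℝ) (fun _ => μ) e
  have h := hmp.quasiMeasurePreserving.ae (ae_eval_ne_zero_fin μ (MvPolynomial.rename e P)
    (by rwa [Ne, map_eq_zero_iff _ (MvPolynomial.rename_injective _ e.injective)]))
  filter_upwards [h] with x hx
  rw [MvPolynomial.eval_rename] at hx
  convert hx using 3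
  ext i
  simp [MeasurableEquiv.coe_piCongrLeft, Equiv.piCongrLeft_apply]

theorem measurePreserving_curry {ι κ : Type*} [Fintype ι] [Fintype κ] (μ : Measure ℝ)
    [IsProbabilityMeasure μ] :
    MeasurePreserving (Function.curry : (ι × κ → ℝ) → ι → κ → ℝ)
      (Measure.pi fun _ => μ) (Measure.pi fun _ => Measure.pi fun _ => μ) where
  measurable := measurable_curry
  map_eq := by
    have := Measure.infinitePi_map_curry (fun (_ : ι) (_ : κ) => μ)
    simp only [Measure.infinitePi_eq_pi] at this
    exact this

theorem ae_eval_pair_ne_zero {ι κ ι' κ' : Type*} [Fintype ι] [Fintype κ] [Fintype ι'] [Fintype κ']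
    (μ : Measure ℝ) [IsProbabilityMeasure μ] [NullSingletonClass μ]
    (P : MvPolynomial (ι × κ ⊕ ι' × κ') ℝ) (hP : P ≠ 0) :
    ∀ᵐ x : (ι → κ → ℝ) × (ι' → κ' → ℝ) ∂(Measure.pi fun _ => Measure.pi fun _ => μ).prod
        (Measure.pi fun _ => Measure.pi fun _ => μ),
      MvPolynomial.eval (Sum.elim (Function.uncurry x.1) (Function.uncurry x.2)) P ≠ 0 := by
  have h1 := measurePreserving_sumPiEquivProdPi (X := fun _ : ι × κ ⊕ ι' × κ' => ℝ) (fun _ => μ)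
  have h2 := ((measurePreserving_curry (ι := ι) (κ := κ) μ).prod
    (measurePreserving_curry (ι := ι') (κ := κ') μ)).comp h1
  have hmeas : MeasurableSet {x : (ι → κ → ℝ) × (ι' → κ' → ℝ) |
      MvPolynomial.eval (Sum.elim (Function.uncurry x.1) (Function.uncurry x.2)) P = 0} := by
    refine (isClosed_singleton.preimage
      ((MvPolynomial.continuous_eval P).comp (continuous_pi ?_))).measurableSet
    rintro (⟨i, j⟩ | ⟨i, j⟩) <;> simp only [Sum.elim_inl, Sum.elim_inr, Function.uncurry] <;> fun_prop
  rw [ae_iff]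
  simp only [ne_eq, not_not]
  rw [← h2.measure_preimage hmeas.nullMeasurableSet]
  have h := ae_eval_ne_zero μ P hP
  rw [ae_iff] at h
  simp only [ne_eq, not_not] at h
  convert h using 3 with x
  ext x
  simp only [Set.mem_preimage, Set.mem_ofPred_eq]
  have : Sum.elim (Function.uncurry (Function.curry fun i => x (Sum.inl i)))
    (Function.uncurry (Function.curry fun i => x (Sum.inr i))) = x := by
    ext (i | i) <;> rfl
  conv_rhs => rw [← this]
  rfl

theorem choose_mul_choose_le_pow {d s : ℕ} (hs : 1 ≤ s) (hsd : s ≤ d) :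
    d.choose s * d.choose (d + 1 - s) ≤ d ^ (2 * min s (d + 1 - s)) := by
  have hd : 1 ≤ d := hs.trans hsd
  rcases le_total s (d + 1 - s) with h | h
  · rw [min_eq_left h]
    calc d.choose s * d.choose (d + 1 - s) = d.choose s * d.choose (s - 1) := by
          rw [← Nat.choose_symm (n := d) (k := s - 1) (by omega)]; congr 2; omega
      _ ≤ d ^ s * d ^ (s - 1) := Nat.mul_le_mul (Nat.choose_le_pow _ _) (Nat.choose_le_pow _ _)
      _ = d ^ (s + (s - 1)) := (pow_add _ _ _).symm
      _ ≤ _ := Nat.pow_le_pow_right hd (by omega)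
  · rw [min_eq_right h]
    calc d.choose s * d.choose (d + 1 - s) = d.choose (d - s) * d.choose (d + 1 - s) := by
          rw [Nat.choose_symm hsd]
      _ ≤ d ^ (d - s) * d ^ (d + 1 - s) :=
          Nat.mul_le_mul (Nat.choose_le_pow _ _) (Nat.choose_le_pow _ _)
      _ = d ^ (d - s + (d + 1 - s)) := (pow_add _ _ _).symm
      _ ≤ _ := Nat.pow_le_pow_right hd (by omega)

theorem choose_mul_choose_mul_pow_le {d s : ℕ} (hs : 1 ≤ s) (hsd : s ≤ d) {p K : ℝ}
    (hp0 : 0 ≤ p) (hp1 : p ≤ 1) (hK : 0 ≤ K) (hpd : (K + 2) * Real.log d ≤ p * d / 2) :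
    (d.choose s : ℝ) * d.choose (d + 1 - s) * (1 - p) ^ (s * (d + 1 - s)) ≤ (d : ℝ) ^ (-K) := by
  have hd : (1 : ℝ) ≤ d := by exact_mod_cast hs.trans hsd
  have hd0 : (0 : ℝ) < d := by linarith
  have hlog : 0 ≤ Real.log d := Real.log_nonneg hd
  obtain ⟨m, hm⟩ : ∃ m, m = min s (d + 1 - s) := ⟨_, rfl⟩
  have hm1 : (1 : ℝ) ≤ m := by
    have : 1 ≤ m := by omega
    exact_mod_cast this
  have h1 : (d.choose s : ℝ) * d.choose (d + 1 - s) ≤ Real.exp (2 * m * Real.log d) := by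
    have := choose_mul_choose_le_pow hs hsd
    rw [← hm] at this
    calc (d.choose s : ℝ) * d.choose (d + 1 - s) ≤ (d : ℝ) ^ (2 * m) := by exact_mod_cast this
      _ = Real.exp (2 * m * Real.log d) := by
        rw [← Real.rpow_natCast, Real.rpow_def_of_pos hd0]; push_cast; congr 1; ring
  have hst : (m : ℝ) * d ≤ 2 * ((s * (d + 1 - s) : ℕ) : ℝ) := by
    have : m * d ≤ 2 * (s * (d + 1 - s)) := by
      obtain ⟨t, ht⟩ : ∃ t, t = d + 1 - s := ⟨_, rfl⟩
      rw [← ht] at hm ⊢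
      rcases le_total s t with h | h
      · have : m = s := by omega
        subst this
        have : d ≤ 2 * t := by omega
        nlinarith
      · have : m = t := by omega
        subst this
        have : d ≤ 2 * s := by omega
        nlinarith
    exact_mod_cast this
  have h2 : (1 - p) ^ (s * (d + 1 - s)) ≤ Real.exp (-(m * ((K + 2) * Real.log d))) := by
    calc (1 - p) ^ (s * (d + 1 - s)) ≤ Real.exp (-p) ^ (s * (d + 1 - s)) :=
          pow_le_pow_left₀ (by linarith) (by linarith [Real.add_one_le_exp (-p)]) _
      _ = Real.exp (-(p * (s * (d + 1 - s) : ℕ))) := by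
          rw [← Real.exp_nat_mul]; congr 1; ring
      _ ≤ _ := by
          rw [Real.exp_le_exp, neg_le_neg_iff]
          nlinarith
  calc (d.choose s : ℝ) * d.choose (d + 1 - s) * (1 - p) ^ (s * (d + 1 - s))
      ≤ Real.exp (2 * m * Real.log d) * Real.exp (-(m * ((K + 2) * Real.log d))) :=
        mul_le_mul h1 h2 (pow_nonneg (by linarith) _) (Real.exp_nonneg _)
    _ = Real.exp (-(m * (K * Real.log d))) := by rw [← Real.exp_add]; congr 1; ring
    _ ≤ Real.exp (Real.log d * -K) := by
        rw [Real.exp_le_exp]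
        nlinarith [mul_nonneg hK hlog]
    _ = _ := (Real.rpow_def_of_pos hd0 _).symm

theorem exists_block_of_not_exists_perm {d : ℕ} (r : Fin d → Fin d → Prop)
    (h : ¬ ∃ σ : Equiv.Perm (Fin d), ∀ i, ¬ r i (σ i)) :
    ∃ s ∈ Finset.Icc 1 d, ∃ A ∈ Finset.powersetCard s Finset.univ,
      ∃ B ∈ Finset.powersetCard (d + 1 - s) Finset.univ, ∀ a ∈ A, ∀ b ∈ B, r a b := by
  classical
  let t : Fin d → Finset (Fin d) := fun i => {j | ¬ r i j}
  have hnot : ¬ ∀ A : Finset (Fin d), A.card ≤ (A.biUnion t).card := by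
    rw [Finset.all_card_le_biUnion_card_iff_exists_injective]
    rintro ⟨f, hf, hft⟩
    refine h ⟨Equiv.ofBijective f (Finite.injective_iff_bijective.1 hf), fun i => ?_⟩
    simpa [t] using hft i
  push Not at hnot
  obtain ⟨A, hA⟩ := hnot
  have hAd : A.card ≤ d := by simpa using Finset.card_le_univ A
  have hcard : d + 1 - A.card ≤ (A.biUnion t)ᶜ.card := by
    rw [Finset.card_compl, Fintype.card_fin]; omega
  obtain ⟨B, hB, hBc⟩ := Finset.exists_subset_card_eq hcard
  refine ⟨A.card, Finset.mem_Icc.2 ⟨by omega, hAd⟩, A, by simp, B, by simp [hBc], ?_⟩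
  intro a ha b hb
  by_contra hr
  exact Finset.mem_compl.1 (hB hb) (Finset.mem_biUnion.2 ⟨a, ha, by simpa [t] using hr⟩)

theorem measure_not_exists_perm_le {Ω : Type*} [MeasurableSpace Ω] (μ : Measure Ω) {d : ℕ}
    (hd : 1 ≤ d) {p K : ℝ} (hp0 : 0 ≤ p) (hp1 : p ≤ 1) (hK : 0 ≤ K)
    (hpd : (K + 2) * Real.log d ≤ p * d / 2) (r : Ω → Fin d → Fin d → Prop)
    (hr : ∀ A B : Finset (Fin d), μ {ω | ∀ a ∈ A, ∀ b ∈ B, r ω a b} ≤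
      ENNReal.ofReal ((1 - p) ^ (A.card * B.card))) :
    μ {ω | ¬ ∃ σ : Equiv.Perm (Fin d), ∀ i, ¬ r ω i (σ i)} ≤
      ENNReal.ofReal (d * (d : ℝ) ^ (-K)) := by
  have hsub : {ω | ¬ ∃ σ : Equiv.Perm (Fin d), ∀ i, ¬ r ω i (σ i)} ⊆
      ⋃ s ∈ Finset.Icc 1 d, ⋃ A ∈ Finset.powersetCard s (Finset.univ : Finset (Fin d)),
        ⋃ B ∈ Finset.powersetCard (d + 1 - s) (Finset.univ : Finset (Fin d)),
          {ω | ∀ a ∈ A, ∀ b ∈ B, r ω a b} := by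
    intro ω hω
    obtain ⟨s, hs, A, hA, B, hB, h⟩ := exists_block_of_not_exists_perm _ hω
    simp only [Set.mem_iUnion]
    exact ⟨s, hs, A, hA, B, hB, h⟩
  have hinner : ∀ s ∈ Finset.Icc 1 d,
      μ (⋃ A ∈ Finset.powersetCard s (Finset.univ : Finset (Fin d)),
        ⋃ B ∈ Finset.powersetCard (d + 1 - s) (Finset.univ : Finset (Fin d)),
          {ω | ∀ a ∈ A, ∀ b ∈ B, r ω a b}) ≤ ENNReal.ofReal ((d : ℝ) ^ (-K)) := by
    intro s hs
    obtain ⟨hs1, hsd⟩ := Finset.mem_Icc.1 hs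
    calc _ ≤ ∑ A ∈ Finset.powersetCard s (Finset.univ : Finset (Fin d)),
        ∑ B ∈ Finset.powersetCard (d + 1 - s) (Finset.univ : Finset (Fin d)),
          μ {ω | ∀ a ∈ A, ∀ b ∈ B, r ω a b} :=
          (measure_biUnion_finset_le _ _).trans
            (Finset.sum_le_sum fun A _ => measure_biUnion_finset_le _ _)
      _ ≤ ∑ A ∈ Finset.powersetCard s (Finset.univ : Finset (Fin d)),
        ∑ B ∈ Finset.powersetCard (d + 1 - s) (Finset.univ : Finset (Fin d)),
          ENNReal.ofReal ((1 - p) ^ (s * (d + 1 - s))) := by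
          refine Finset.sum_le_sum fun A hA => Finset.sum_le_sum fun B hB => ?_
          have := hr A B
          rwa [(Finset.mem_powersetCard.1 hA).2, (Finset.mem_powersetCard.1 hB).2] at this
      _ = ENNReal.ofReal
          ((d.choose s : ℝ) * d.choose (d + 1 - s) * (1 - p) ^ (s * (d + 1 - s))) := by
          have : 0 ≤ (1 - p) ^ (s * (d + 1 - s)) := pow_nonneg (by linarith) _
          simp only [Finset.sum_const, Finset.card_powersetCard, Finset.card_univ,
            Fintype.card_fin, nsmul_eq_mul]
          rw [ENNReal.ofReal_mul (by positivity), ENNReal.ofReal_mul (by positivity),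
            ENNReal.ofReal_natCast, ENNReal.ofReal_natCast, mul_assoc]
      _ ≤ _ := ENNReal.ofReal_le_ofReal
          (choose_mul_choose_mul_pow_le hs1 hsd hp0 hp1 hK hpd)
  calc _ ≤ ∑ s ∈ Finset.Icc 1 d, ENNReal.ofReal ((d : ℝ) ^ (-K)) :=
        (measure_mono hsub).trans ((measure_biUnion_finset_le _ _).trans
          (Finset.sum_le_sum hinner))
    _ = _ := by
      rw [Finset.sum_const, Nat.card_Icc, Nat.add_sub_cancel, nsmul_eq_mul,
        ENNReal.ofReal_mul (by positivity), ENNReal.ofReal_natCast]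

theorem isProbabilityMeasure_bern {p : ℝ} (hp0 : 0 ≤ p) (hp1 : p ≤ 1) :
    IsProbabilityMeasure (bern p) := by
  constructor
  simp only [bern, Measure.coe_add, Measure.coe_smul, Pi.add_apply, Pi.smul_apply, measure_univ,
    smul_eq_mul, mul_one]
  rw [← ENNReal.ofReal_add hp0 (by linarith)]
  simp

theorem bern_singleton_zero (p : ℝ) : bern p {0} = ENNReal.ofReal (1 - p) := by
  simp [bern]

theorem pi_bern_block_eq_zero {p : ℝ} (hp0 : 0 ≤ p) (hp1 : p ≤ 1) {ι κ : Type*} [Fintype ι]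
    [Fintype κ] (A : Finset ι) (B : Finset κ) :
    (Measure.pi fun _ : ι => Measure.pi fun _ : κ => bern p)
      {m | ∀ a ∈ A, ∀ b ∈ B, m a b = 0} = ENNReal.ofReal ((1 - p) ^ (A.card * B.card)) := by
  have := isProbabilityMeasure_bern hp0 hp1
  have hset : {m : ι → κ → ℝ | ∀ a ∈ A, ∀ b ∈ B, m a b = 0} =
      (A : Set ι).pi fun _ => (B : Set κ).pi fun _ => {0} := by
    ext m
    simp [Set.mem_pi]
  rw [hset, ← Measure.infinitePi_eq_pi, Measure.infinitePi_pi _ fun _ _ =>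
    MeasurableSet.pi B.countable_toSet fun _ _ => measurableSet_singleton _]
  simp only [← Measure.infinitePi_eq_pi]
  rw [Measure.infinitePi_pi _ fun _ _ => measurableSet_singleton _]
  simp only [bern_singleton_zero, Finset.prod_const]
  rw [← pow_mul, ENNReal.ofReal_pow (by linarith), mul_comm]

/-- The masks of a block leave a system of distinct representatives: the hidden neurons are matched
bijectively with (output, input) pairs through surviving weights. -/
def HasMatching {d : ℕ} (m : (Fin (d * d) → Fin d → ℝ) × (Fin d → Fin (d * d) → ℝ)) : Prop :=
  ∃ π : Equiv.Perm (Fin d × Fin d), ∀ k,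
    m.1 (finProdFinEquiv k) (π k).2 ≠ 0 ∧ m.2 (π k).1 (finProdFinEquiv k) ≠ 0

theorem measurableSet_not_hasMatching (d : ℕ) :
    MeasurableSet {m : (Fin (d * d) → Fin d → ℝ) × (Fin d → Fin (d * d) → ℝ) |
      ¬ HasMatching m} := by
  have hset : {m : (Fin (d * d) → Fin d → ℝ) × (Fin d → Fin (d * d) → ℝ) | HasMatching m} =
      ⋃ π : Equiv.Perm (Fin d × Fin d), ⋂ k, {m | m.1 (finProdFinEquiv k) (π k).2 ≠ 0} ∩
        {m | m.2 (π k).1 (finProdFinEquiv k) ≠ 0} := by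
    ext m
    simp [HasMatching]
  have h : MeasurableSet
      {m : (Fin (d * d) → Fin d → ℝ) × (Fin d → Fin (d * d) → ℝ) | HasMatching m} := by
    rw [hset]
    refine MeasurableSet.iUnion fun π => MeasurableSet.iInter fun k => MeasurableSet.inter ?_ ?_
    · exact (measurableSet_singleton (0 : ℝ)).compl.preimage (by fun_prop)
    · exact (measurableSet_singleton (0 : ℝ)).compl.preimage (by fun_prop)
  exact h.compl

theorem hasMatching_of_perms {d : ℕ} (m : (Fin (d * d) → Fin d → ℝ) × (Fin d → Fin (d * d) → ℝ))
    (σ τ : Fin d → Equiv.Perm (Fin d))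
    (hσ : ∀ v u, m.1 (finProdFinEquiv (u, v)) (σ v u) ≠ 0)
    (hτ : ∀ j i, m.2 i (finProdFinEquiv ((σ (τ j i)).symm j, τ j i)) ≠ 0) : HasMatching m := by
  let f : Fin d × Fin d → Fin d × Fin d := fun k => ((τ (σ k.2 k.1)).symm k.2, σ k.2 k.1)
  have hf : Function.Injective f := by
    rintro ⟨u, v⟩ ⟨u', v'⟩ h
    simp only [f, Prod.mk.injEq] at h
    obtain ⟨h1, h2⟩ := h
    rw [h2] at h1
    obtain rfl := (Equiv.injective _) h1
    obtain rfl := (Equiv.injective _) h2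
    rfl
  refine ⟨Equiv.ofBijective f (Finite.injective_iff_bijective.1 hf), fun ⟨u, v⟩ => ⟨hσ v u, ?_⟩⟩
  simpa [f] using hτ (σ v u) ((τ (σ v u)).symm v)

theorem measure_not_hasMatching_le {d : ℕ} (hd : 1 ≤ d) {p K : ℝ} (hp0 : 0 ≤ p) (hp1 : p ≤ 1)
    (hK : 0 ≤ K) (hpd : (K + 2) * Real.log d ≤ p * d / 2) :
    ((Measure.pi fun _ : Fin (d * d) => Measure.pi fun _ : Fin d => bern p).prod
      (Measure.pi fun _ : Fin d => Measure.pi fun _ : Fin (d * d) => bern p))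
        {m | ¬ HasMatching m} ≤ ENNReal.ofReal (2 * (d * (d * (d : ℝ) ^ (-K)))) := by
  have := isProbabilityMeasure_bern hp0 hp1
  set q := ENNReal.ofReal (d * (d : ℝ) ^ (-K)) with hq
  let bad : Set (Fin (d * d) → Fin d → ℝ) :=
    ⋃ v : Fin d, {m | ¬ ∃ σ : Equiv.Perm (Fin d), ∀ u, ¬ m (finProdFinEquiv (u, v)) (σ u) = 0}
  have hunion : ∀ {Ω : Type} [MeasurableSpace Ω] (μ : Measure Ω) (s : Fin d → Set Ω),
      (∀ v, μ (s v) ≤ q) → μ (⋃ v, s v) ≤ d * q := by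
    intro Ω _ μ s h
    refine (measure_iUnion_fintype_le μ s).trans ((Finset.sum_le_sum fun v _ => h v).trans ?_)
    simp
  have hbad : (Measure.pi fun _ : Fin (d * d) => Measure.pi fun _ : Fin d => bern p) bad ≤
      d * q := by
    refine hunion _ _ fun v => ?_
    refine measure_not_exists_perm_le _ hd hp0 hp1 hK hpd
      (fun (m : Fin (d * d) → Fin d → ℝ) u j => m (finProdFinEquiv (u, v)) j = 0) fun A B => ?_
    have := pi_bern_block_eq_zero hp0 hp1 (A.image fun u => finProdFinEquiv (u, v)) B
    rw [Finset.card_image_of_injective _ fun u u' h => by simpa using h] at this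
    rw [← this]
    simp
  have hslice : ∀ mo ∉ bad, (Measure.pi fun _ : Fin d => Measure.pi fun _ : Fin (d * d) => bern p)
      {me | ¬ HasMatching (mo, me)} ≤ d * q := by
    intro mo hmo
    rw [Set.mem_iUnion, not_exists] at hmo
    have hmo' : ∀ v, ∃ σ : Equiv.Perm (Fin d), ∀ u, ¬ mo (finProdFinEquiv (u, v)) (σ u) = 0 :=
      fun v => not_not.1 (hmo v)
    choose σ hσ using hmo'
    refine (measure_mono ?_).trans (hunion _ (fun j => {me | ¬ ∃ τ : Equiv.Perm (Fin d),
      ∀ i, ¬ me i (finProdFinEquiv ((σ (τ i)).symm j, τ i)) = 0}) fun j => ?_)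
    · intro me hme
      by_contra hcon
      rw [Set.mem_iUnion, not_exists] at hcon
      have hcon' : ∀ j, ∃ τ : Equiv.Perm (Fin d),
        ∀ i, ¬ me i (finProdFinEquiv ((σ (τ i)).symm j, τ i)) = 0 := fun j => not_not.1 (hcon j)
      choose τ hτ using hcon'
      exact hme (hasMatching_of_perms _ σ τ hσ hτ)
    · refine measure_not_exists_perm_le _ hd hp0 hp1 hK hpd
        (fun (m : Fin d → Fin (d * d) → ℝ) i v => m i (finProdFinEquiv ((σ v).symm j, v)) = 0)
        fun A B => ?_
      have := pi_bern_block_eq_zero hp0 hp1 A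
        (B.image fun v => finProdFinEquiv ((σ v).symm j, v))
      rw [Finset.card_image_of_injective _ fun v v' h => by
        simp only [EmbeddingLike.apply_eq_iff_eq, Prod.mk.injEq] at h
        exact h.2] at this
      rw [← this]
      simp
  rw [Measure.prod_apply (measurableSet_not_hasMatching d)]
  calc _ ≤ ∫⁻ mo, (bad.indicator 1 mo + d * q)
        ∂(Measure.pi fun _ : Fin (d * d) => Measure.pi fun _ : Fin d => bern p) := by
        refine lintegral_mono fun mo => ?_
        by_cases h : mo ∈ bad
        · simp only [Set.indicator_of_mem h, Pi.one_apply]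
          exact prob_le_one.trans le_self_add
        · simp only [Set.indicator_of_notMem h, zero_add]
          exact hslice mo h
    _ ≤ d * q + d * q := by
        rw [lintegral_add_right _ measurable_const]
        gcongr
        · exact (lintegral_indicator_one_le _).trans hbad
        · simp
    _ = _ := by
        rw [ENNReal.ofReal_mul (by norm_num), ENNReal.ofReal_mul (p := d) (by positivity), ← hq,
          ENNReal.ofReal_natCast, ENNReal.ofReal_ofNat, two_mul]

/-- The matrix of the linear map sending hidden scalings `γ` to the product `We diag(γ) Wo`, with
entries indexed by (output, input) pairs and hidden neurons. -/
def scalingMatrix {R : Type*} [CommRing R] {d : ℕ} (Wo : Fin (d * d) → Fin d → R)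
    (We : Fin d → Fin (d * d) → R) : Matrix (Fin d × Fin d) (Fin d × Fin d) R :=
  of fun a k => We a.1 (finProdFinEquiv k) * Wo (finProdFinEquiv k) a.2

theorem exists_scaling {d : ℕ} {Wo : Fin (d * d) → Fin d → ℝ} {We : Fin d → Fin (d * d) → ℝ}
    (h : (scalingMatrix Wo We).det ≠ 0) (T : Matrix (Fin d) (Fin d) ℝ) :
    ∃ γ : Fin (d * d) → ℝ, of We * diagonal γ * of Wo = T := by
  obtain ⟨g, hg⟩ := (mulVec_surjective_iff_isUnit.2
    ((Matrix.isUnit_iff_isUnit_det _).2 h.isUnit)) fun a : Fin d × Fin d => T a.1 a.2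
  refine ⟨fun k => g (finProdFinEquiv.symm k), ?_⟩
  ext i j
  have := congrFun hg (i, j)
  simp only [mulVec, dotProduct, scalingMatrix, of_apply] at this
  rw [← this, Matrix.mul_apply, ← Equiv.sum_comp finProdFinEquiv]
  refine Finset.sum_congr rfl fun k _ => ?_
  rw [Matrix.mul_diagonal, of_apply, of_apply, Equiv.symm_apply_apply]
  ring

theorem ae_det_scalingMatrix_ne_zero {d : ℕ} (ν : Measure ℝ) [IsProbabilityMeasure ν]
    [NullSingletonClass ν] (m : (Fin (d * d) → Fin d → ℝ) × (Fin d → Fin (d * d) → ℝ))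
    (hm : HasMatching m) :
    ∀ᵐ x : (Fin (d * d) → Fin d → ℝ) × (Fin d → Fin (d * d) → ℝ)
        ∂(Measure.pi fun _ => Measure.pi fun _ => ν).prod
          (Measure.pi fun _ => Measure.pi fun _ => ν),
      (scalingMatrix (x.1 * m.1) (x.2 * m.2)).det ≠ 0 := by
  let P : MvPolynomial (Fin (d * d) × Fin d ⊕ Fin d × Fin (d * d)) ℝ :=
    (scalingMatrix (fun k j => MvPolynomial.X (Sum.inl (k, j)) * MvPolynomial.C (m.1 k j))
      (fun i k => MvPolynomial.X (Sum.inr (i, k)) * MvPolynomial.C (m.2 i k))).det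
  have heval : ∀ x : (Fin (d * d) → Fin d → ℝ) × (Fin d → Fin (d * d) → ℝ),
      MvPolynomial.eval (Sum.elim (Function.uncurry x.1) (Function.uncurry x.2)) P =
        (scalingMatrix (x.1 * m.1) (x.2 * m.2)).det := by
    intro x
    rw [RingHom.map_det]
    congr 1
    ext a k
    simp [scalingMatrix]
  have hP : P ≠ 0 := by
    obtain ⟨π, hπ⟩ := hm
    intro hP0
    have h := heval (fun k j => if j = (π (finProdFinEquiv.symm k)).2 then (m.1 k j)⁻¹ else 0,
      fun i k => if i = (π (finProdFinEquiv.symm k)).1 then (m.2 i k)⁻¹ else 0)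
    have hperm : scalingMatrix
        ((fun k j => if j = (π (finProdFinEquiv.symm k)).2 then (m.1 k j)⁻¹ else 0) * m.1)
        ((fun i k => if i = (π (finProdFinEquiv.symm k)).1 then (m.2 i k)⁻¹ else 0) * m.2) =
        (π⁻¹ : Equiv.Perm _).toPEquiv.toMatrix := by
      ext ⟨i, j⟩ k
      obtain ⟨h1, h2⟩ := hπ k
      have hiff : (π⁻¹ (i, j) = k) ↔ i = (π k).1 ∧ j = (π k).2 := by
        rw [Equiv.Perm.inv_eq_iff_eq, Prod.ext_iff]
      simp only [scalingMatrix, of_apply, Pi.mul_apply, Equiv.symm_apply_apply,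
        PEquiv.toMatrix_apply, Equiv.toPEquiv_apply, Option.mem_some_iff, hiff]
      by_cases hi : i = (π k).1
      · by_cases hj : j = (π k).2
        · subst hi hj
          simp [h1, h2]
        · simp [hj]
      · simp [hi]
    rw [hP0, map_zero, hperm, Matrix.det_permutation] at h
    rcases Int.units_eq_one_or (Equiv.Perm.sign π⁻¹) with h' | h' <;> simp [h'] at h
  filter_upwards [ae_eval_pair_ne_zero ν P hP] with x hx
  rwa [heval] at hx

theorem measurableSet_det_scalingMatrix_eq_zero (d : ℕ) :
    MeasurableSet {x : (Fin (d * d) → Fin d → ℝ) × (Fin d → Fin (d * d) → ℝ) ×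
      (Fin (d * d) → Fin d → ℝ) × (Fin d → Fin (d * d) → ℝ) |
      (scalingMatrix (x.1 * x.2.2.1) (x.2.1 * x.2.2.2)).det = 0} := by
  refine (isClosed_eq (Continuous.matrix_det (continuous_matrix fun a k => ?_))
    continuous_const).measurableSet
  simp only [scalingMatrix, of_apply, Pi.mul_apply]
  fun_prop

theorem measure_det_scalingMatrix_eq_zero_le {d : ℕ} (hd : 1 ≤ d) {p K : ℝ} (hp0 : 0 ≤ p)
    (hp1 : p ≤ 1) (hK : 0 ≤ K) (hpd : (K + 2) * Real.log d ≤ p * d / 2) (ν : Measure ℝ)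
    [IsProbabilityMeasure ν] [NullSingletonClass ν] :
    ((Measure.pi fun _ : Fin (d * d) => Measure.pi fun _ : Fin d => ν).prod
      ((Measure.pi fun _ : Fin d => Measure.pi fun _ : Fin (d * d) => ν).prod
        ((Measure.pi fun _ : Fin (d * d) => Measure.pi fun _ : Fin d => bern p).prod
          (Measure.pi fun _ : Fin d => Measure.pi fun _ : Fin (d * d) => bern p))))
      {x | (scalingMatrix (x.1 * x.2.2.1) (x.2.1 * x.2.2.2)).det = 0} ≤
        ENNReal.ofReal (2 * (d * (d * (d : ℝ) ^ (-K)))) := by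
  have := isProbabilityMeasure_bern hp0 hp1
  have hmp := measurePreserving_prodAssoc
    (Measure.pi fun _ : Fin (d * d) => Measure.pi fun _ : Fin d => ν)
    (Measure.pi fun _ : Fin d => Measure.pi fun _ : Fin (d * d) => ν)
    ((Measure.pi fun _ : Fin (d * d) => Measure.pi fun _ : Fin d => bern p).prod
      (Measure.pi fun _ : Fin d => Measure.pi fun _ : Fin (d * d) => bern p))
  have hmeas := measurableSet_det_scalingMatrix_eq_zero d
  rw [← hmp.measure_preimage hmeas.nullMeasurableSet,
    Measure.prod_apply_symm (hmp.measurable hmeas)]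
  refine le_trans (lintegral_mono fun m => ?_)
    ((lintegral_indicator_one_le {m | ¬ HasMatching m}).trans
      (measure_not_hasMatching_le hd hp0 hp1 hK hpd))
  by_cases hm : HasMatching m
  · have := ae_det_scalingMatrix_ne_zero ν m hm
    rw [ae_iff] at this
    simp only [ne_eq, not_not] at this
    exact (le_of_eq this).trans zero_le
  · rw [Set.indicator_of_mem (by exact hm)]
    exact prob_le_one

theorem abs_le_one_of_eNorm_le_one {d : ℕ} {x : Fin d → ℝ} (hx : eNorm x ≤ 1) (j : Fin d) :
    |x j| ≤ 1 := by
  refine le_trans ?_ hx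
  rw [eNorm, ← Real.sqrt_sq_eq_abs]
  exact Real.sqrt_le_sqrt (Finset.single_le_sum (f := fun i => x i ^ 2)
    (fun i _ => sq_nonneg _) (Finset.mem_univ j))

theorem continuous_chain {α : Type*} [TopologicalSpace α] {step : ℕ → α → α}
    (h : ∀ k, Continuous (step k)) (k : ℕ) : Continuous (chain step k) := by
  induction k with
  | zero => exact continuous_id
  | succ k ih => exact (h k).comp ih

theorem continuous_reluV_gLayer {d : ℕ} (Γ : Fin d → ℝ) (V : Matrix (Fin d) (Fin d) ℝ)
    (β : Fin d → ℝ) : Continuous fun y => reluV (gLayer Γ V β y) := by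
  have h : Continuous fun y => gLayer Γ V β y := by
    unfold gLayer
    fun_prop
  refine continuous_pi fun i => ?_
  exact ((continuous_apply i).comp h).max continuous_const

theorem exists_bound_of_continuous {d : ℕ} {F : (Fin d → ℝ) → Fin d → ℝ} (hF : Continuous F) :
    ∃ R : ℝ, ∀ x, eNorm x ≤ 1 → ∀ j, |F x j| ≤ R := by
  obtain ⟨R, hR⟩ := (isCompact_closedBall (0 : Fin d → ℝ) 1).exists_bound_of_continuousOn
    hF.continuousOn
  refine ⟨R, fun x hx j => (norm_le_pi_norm (F x) j).trans (hR x ?_)⟩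
  rw [mem_closedBall_zero_iff, pi_norm_le_iff_of_nonneg zero_le_one]
  exact abs_le_one_of_eNorm_le_one hx

theorem exists_fBlock_eq_gLayer {d : ℕ} {Wo : Matrix (Fin (d * d)) (Fin d) ℝ}
    {We : Matrix (Fin d) (Fin (d * d)) ℝ} {γ : Fin (d * d) → ℝ} {Γ : Fin d → ℝ}
    {V : Matrix (Fin d) (Fin d) ℝ} (h : We * diagonal γ * Wo = diagonal Γ * V)
    (β : Fin d → ℝ) (R : ℝ) :
    ∃ (βo : Fin (d * d) → ℝ) (βe : Fin d → ℝ), ∀ y : Fin d → ℝ, (∀ j, |y j| ≤ R) →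
      fBlock γ βo 1 βe Wo We y = gLayer Γ V β y := by
  let βo : Fin (d * d) → ℝ := fun k => ∑ j, |(diagonal γ * Wo) k j| * R
  refine ⟨βo, β - We *ᵥ βo, fun y hy => ?_⟩
  have hrelu : reluV (diagonal γ *ᵥ (Wo *ᵥ y) + βo) = diagonal γ *ᵥ (Wo *ᵥ y) + βo := by
    ext k
    refine max_eq_left ?_
    rw [Pi.add_apply, mulVec_mulVec]
    simp only [mulVec, dotProduct, βo]
    rw [← Finset.sum_add_distrib]
    refine Finset.sum_nonneg fun j _ => ?_
    have h1 := neg_abs_le ((diagonal γ * Wo) k j * y j)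
    rw [abs_mul] at h1
    have h2 := mul_le_mul_of_nonneg_left (hy j) (abs_nonneg ((diagonal γ * Wo) k j))
    linarith
  rw [fBlock, hrelu, gLayer, mulVec_add, mulVec_mulVec, mulVec_mulVec, mulVec_mulVec,
    h]
  have h1 : (diagonal (1 : Fin d → ℝ)) = 1 := diagonal_one
  rw [h1, one_mulVec]
  abel

theorem ext_of_lt {l : ℕ} {α : Type*} [Zero α] (f : Fin l → α) {k : ℕ} (hk : k < l) :
    ext f k = f ⟨k, hk⟩ := dif_pos hk

theorem exists_fNet_eq_gNet {d l : ℕ} (hl : 1 ≤ l) (Wo : Fin l → Matrix (Fin (d * d)) (Fin d) ℝ)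
    (We : Fin l → Matrix (Fin d) (Fin (d * d)) ℝ) (h : ∀ i, (scalingMatrix (Wo i) (We i)).det ≠ 0)
    (V : Fin l → Matrix (Fin d) (Fin d) ℝ) (Γ β : Fin l → Fin d → ℝ) :
    ∃ (Γo βo : Fin l → Fin (d * d) → ℝ) (Γe βe : Fin l → Fin d → ℝ),
      ∀ x : Fin d → ℝ, eNorm x ≤ 1 →
        fNet d l (ext Γo) (ext βo) (ext Γe) (ext βe) (ext Wo) (ext We) x =
          gNet d l (ext Γ) (ext V) (ext β) x := by
  choose γ hγ using fun i => exists_scaling (h i) (diagonal (Γ i) * V i)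
  let g := chain fun k y => reluV (gLayer (ext Γ k) (ext V k) (ext β k) y)
  choose R hR using fun k => exists_bound_of_continuous
    (continuous_chain (fun k => continuous_reluV_gLayer (ext Γ k) (ext V k) (ext β k)) k)
  choose βo βe hβ using fun i : Fin l => exists_fBlock_eq_gLayer (hγ i) (β i) (R i)
  refine ⟨γ, βo, fun _ => 1, βe, fun x hx => ?_⟩
  have hstep : ∀ k < l, fBlock (ext γ k) (ext βo k) (ext (fun _ : Fin l => 1) k) (ext βe k)
      (ext Wo k) (ext We k) (g k x) = gLayer (ext Γ k) (ext V k) (ext β k) (g k x) := by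
    intro k hk
    simp only [ext_of_lt _ hk]
    exact hβ ⟨k, hk⟩ _ (hR k x hx)
  have hchain : ∀ k ≤ l - 1, chain (fun k y => reluV (fBlock (ext γ k) (ext βo k)
      (ext (fun _ : Fin l => 1) k) (ext βe k) (ext Wo k) (ext We k) y)) k x = g k x := by
    intro k
    induction k with
    | zero => exact fun _ => rfl
    | succ k ih =>
      intro hk
      simp only [chain]
      rw [ih (by omega), hstep k (by omega)]
      rfl
  rw [fNet, hchain _ le_rfl, hstep _ (by omega)]
  rfl

theorem measurePreserving_jointLaw_eval {d l : ℕ} {ν : Measure ℝ} [IsProbabilityMeasure ν] {p : ℝ}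
    (hp0 : 0 ≤ p) (hp1 : p ≤ 1) (i : Fin l) :
    MeasurePreserving (fun ω : (Fin l → Fin (d * d) → Fin d → ℝ) ×
        (Fin l → Fin d → Fin (d * d) → ℝ) × (Fin l → Fin (d * d) → Fin d → ℝ) ×
        (Fin l → Fin d → Fin (d * d) → ℝ) => (ω.1 i, ω.2.1 i, ω.2.2.1 i, ω.2.2.2 i))
      (jointLaw d l ν p)
      ((Measure.pi fun _ : Fin (d * d) => Measure.pi fun _ : Fin d => ν).prod
        ((Measure.pi fun _ : Fin d => Measure.pi fun _ : Fin (d * d) => ν).prod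
          ((Measure.pi fun _ : Fin (d * d) => Measure.pi fun _ : Fin d => bern p).prod
            (Measure.pi fun _ : Fin d => Measure.pi fun _ : Fin (d * d) => bern p)))) := by
  have := isProbabilityMeasure_bern hp0 hp1
  exact (measurePreserving_eval _ i).prod ((measurePreserving_eval _ i).prod
    ((measurePreserving_eval _ i).prod (measurePreserving_eval _ i)))

theorem mul_log_le_mul_div_two {C p : ℝ} {d : ℕ} (hC : 0 ≤ C) (hd : 1 ≤ d)
    (hp : 2 * C * Real.sqrt (Real.log d / d) ≤ p) : C * Real.log d ≤ p * d / 2 := by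
  have hd' : (1 : ℝ) ≤ d := by exact_mod_cast hd
  set t := Real.log d / d with ht
  have ht0 : 0 ≤ t := div_nonneg (Real.log_nonneg hd') (by linarith)
  have ht1 : t ≤ 1 := by
    rw [ht, div_le_one (by linarith)]
    linarith [Real.log_le_sub_one_of_pos (by linarith : (0 : ℝ) < d)]
  have hsq : t ≤ Real.sqrt t := by
    rw [Real.le_sqrt ht0 ht0]
    nlinarith
  have hlog : Real.log d = t * d := by rw [ht]; field_simp
  have h1 : 2 * C * t ≤ p := (mul_le_mul_of_nonneg_left hsq (by linarith)).trans hp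
  rw [hlog]
  nlinarith

theorem depth_mul_failure_le {a : ℝ} {d l : ℕ} (hd : 2 ≤ d) (hl : (l : ℝ) ≤ (d : ℝ) ^ a) :
    l * (2 * (d * (d * (d : ℝ) ^ (-(a + 4))))) ≤ 1 / d := by
  have hd' : (2 : ℝ) ≤ d := by exact_mod_cast hd
  have hd0 : (0 : ℝ) < d := by linarith
  have hpow : (d : ℝ) ^ (-(a + 4)) = ((d : ℝ) ^ a)⁻¹ * ((d : ℝ) ^ 4)⁻¹ := by
    rw [Real.rpow_neg hd0.le, Real.rpow_add hd0, mul_inv]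
    rw [show (4 : ℝ) = (4 : ℕ) by norm_num, Real.rpow_natCast]
  have ha : 0 < (d : ℝ) ^ a := Real.rpow_pos_of_pos hd0 a
  calc l * (2 * (d * (d * (d : ℝ) ^ (-(a + 4)))))
      ≤ (d : ℝ) ^ a * (2 * (d * (d * (d : ℝ) ^ (-(a + 4))))) := by gcongr
    _ = 2 / (d : ℝ) ^ 2 := by rw [hpow]; field_simp
    _ ≤ 1 / d := by rw [div_le_div_iff₀ (by positivity) hd0]; nlinarith

/-- For every `a > 0` there are `C > 0` and `d₀` such that for all `d ≥ d₀`,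
all depths `l ≤ d^a`, all sparsity levels `p` with `C√(log d / d) ≤ p ≤ 1`, and any entry
distribution `ν ≪ Lebesgue`: with probability at least `1 − 1/d` over the i.i.d. weights and
independent Bernoulli(p) masks, every width-`d`, depth-`l` target ReLU network (with
`‖V_i‖_F ≤ 1`, diagonal `Γ*_i`) is exactly realized on the unit ball by tuning only the
normalization parameters of the masked random network. -/
theorem sparse_wide_reconstruction :
    ∀ a : ℝ, 0 < a → ∃ C : ℝ, 0 < C ∧ ∃ d0 : ℕ, ∀ d l : ℕ, d0 ≤ d → 1 ≤ l →
      (l : ℝ) ≤ (d : ℝ) ^ a →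
      ∀ p : ℝ, C * Real.sqrt (Real.log d / d) ≤ p → p ≤ 1 →
      ∀ ν : Measure ℝ, IsProbabilityMeasure ν → ν ≪ volume →
      1 - 1 / (d : ℝ≥0∞) ≤
        jointLaw d l ν p
          {ω | ∀ (V : Fin l → Matrix (Fin d) (Fin d) ℝ) (Γstar βstar : Fin l → Fin d → ℝ),
            (∀ i, frob (V i) ≤ 1) →
            ∃ (Γo βo : Fin l → Fin (d * d) → ℝ) (Γe βe : Fin l → Fin d → ℝ),
              ∀ x : Fin d → ℝ, eNorm x ≤ 1 →
                fNet d l (ext Γo) (ext βo) (ext Γe) (ext βe)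
                    (ext fun i => of fun r c => ω.1 i r c * ω.2.2.1 i r c)
                    (ext fun i => of fun r c => ω.2.1 i r c * ω.2.2.2 i r c) x
                  = gNet d l (ext Γstar) (ext V) (ext βstar) x} := by
  intro a ha
  refine ⟨2 * (a + 6), by positivity, 2, ?_⟩
  intro d l hd hl hla p hp hp1 ν hν hac
  have hp0 : 0 ≤ p := le_trans (by positivity) hp
  have : NullSingletonClass ν := ⟨fun x => hac (measure_singleton x)⟩
  have := isProbabilityMeasure_bern hp0 hp1
  have hlog : (a + 4 + 2) * Real.log d ≤ p * d / 2 :=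
    mul_log_le_mul_div_two (by positivity) (by omega) (by convert hp using 3; ring)
  have hblock := measure_det_scalingMatrix_eq_zero_le (d := d) (by omega) hp0 hp1
    (by positivity : 0 ≤ a + 4) hlog ν
  let bad := ⋃ i : Fin l, (fun ω : (Fin l → Fin (d * d) → Fin d → ℝ) ×
        (Fin l → Fin d → Fin (d * d) → ℝ) × (Fin l → Fin (d * d) → Fin d → ℝ) ×
        (Fin l → Fin d → Fin (d * d) → ℝ) => (ω.1 i, ω.2.1 i, ω.2.2.1 i, ω.2.2.2 i)) ⁻¹'
      {x | (scalingMatrix (x.1 * x.2.2.1) (x.2.1 * x.2.2.2)).det = 0}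
  have hbad : jointLaw d l ν p bad ≤ 1 / (d : ℝ≥0∞) := by
    calc jointLaw d l ν p bad
        ≤ ∑ _i : Fin l, ENNReal.ofReal (2 * (d * (d * (d : ℝ) ^ (-(a + 4))))) := by
          refine (measure_iUnion_fintype_le _ _).trans (Finset.sum_le_sum fun i _ => ?_)
          rw [(measurePreserving_jointLaw_eval hp0 hp1 i).measure_preimage
            (measurableSet_det_scalingMatrix_eq_zero d).nullMeasurableSet]
          exact hblock
      _ = ENNReal.ofReal (l * (2 * (d * (d * (d : ℝ) ^ (-(a + 4)))))) := by
          rw [ENNReal.ofReal_mul (p := l) (by positivity), ENNReal.ofReal_natCast]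
          simp
      _ ≤ ENNReal.ofReal (1 / d) := ENNReal.ofReal_le_ofReal (depth_mul_failure_le hd hla)
      _ = 1 / (d : ℝ≥0∞) := by
          have hd0 : (0 : ℝ) < d := by exact_mod_cast (by omega : 0 < d)
          rw [ENNReal.ofReal_div_of_pos hd0, ENNReal.ofReal_one, ENNReal.ofReal_natCast]
  have hprob : IsProbabilityMeasure (jointLaw d l ν p) := by
    unfold jointLaw
    infer_instance
  rw [tsub_le_iff_right]
  refine (measure_univ (μ := jointLaw d l ν p)).ge.trans ((measure_mono fun ω _ => ?_).trans
    ((measure_union_le _ bad).trans (add_le_add_right hbad _)))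
  by_cases hω : ω ∈ bad
  · exact Or.inr hω
  · refine Or.inl fun V Γ β _ => ?_
    refine exists_fNet_eq_gNet hl _ _ (fun i hi => hω ?_) V Γ β
    exact Set.mem_iUnion.2 ⟨i, hi⟩
end
end

section
/- Fix d ≥ 1, k, r ≥ 1, and diagonal matrices Δ_1, …, Δ_r ∈ ℝ^{dk×dk} all of whose diagonal entries are nonzero. For Lebesgue-almost every tuple (U, V_1, …, V_r, W, P) with U ∈ ℝ^{d×dk}, V_1, …, V_r ∈ ℝ^{dk×dk}, W ∈ ℝ^{dk×dk} and P ∈ ℝ^{dk×k}, the dk×dk matrix (U Δ_1 V_1 Δ_2 V_2 ⋯ Δ_r V_r) ⊛ (Pᵀ Wᵀ) is invertible. -/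
noncomputable section
open MeasureTheory Matrix

/-- The Khatri-Rao (column-wise Kronecker) product of `A ∈ ℝ^{n×nm}` and `B ∈ ℝ^{m×nm}`:
the entry in row `i·m + j` and column `k` is `A i k * B j k`. -/
def kr {α : Type*} [Mul α] {n m : ℕ} (A : Matrix (Fin n) (Fin (n * m)) α)
    (B : Matrix (Fin m) (Fin (n * m)) α) : Matrix (Fin (n * m)) (Fin (n * m)) α :=
  of fun r k => A r.divNat k * B r.modNat k

/-- A real analytic function on a finite-dimensional space which is nonzero somewhere is nonzero
almost everywhere for any additive Haar measure. -/
theorem AnalyticOnNhd.ae_ne_zero {E : Type*} [NormedAddCommGroup E] [NormedSpace ℝ E]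
    [FiniteDimensional ℝ E] [MeasurableSpace E] [BorelSpace E] (μ : Measure E) [μ.IsAddHaarMeasure]
    {f : E → ℝ} (hf : AnalyticOnNhd ℝ f Set.univ) {x₀ : E} (hx₀ : f x₀ ≠ 0) :
    ∀ᵐ x ∂μ, f x ≠ 0 := by
  have hc : Continuous f := continuousOn_univ.1 hf.continuousOn
  have hline (v : E) : ∀ᵐ t : ℝ, f (x₀ + t • v) ≠ 0 := by
    have hg : AnalyticOnNhd ℝ (fun t : ℝ => f (x₀ + t • v)) Set.univ := fun t _ =>
      (hf (x₀ + t • v) trivial).fun_comp (f := fun t : ℝ => x₀ + t • v) (by fun_prop)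
    have hz := hg.eqOn_zero_or_eventually_ne_zero_of_preconnected isPreconnected_univ
    rcases hz with hz | hz
    · exact absurd (by simpa using hz (Set.mem_univ 0)) hx₀
    · have := ae_restrict_le_codiscreteWithin (μ := volume) MeasurableSet.univ hz
      rwa [Measure.restrict_univ] at this
  have hmeas : MeasurableSet {p : E × ℝ | f (x₀ + p.2 • p.1) ≠ 0} :=
    (isOpen_ne.preimage
      (by fun_prop : Continuous fun p : E × ℝ => f (x₀ + p.2 • p.1))).measurableSet
  have hswap : ∀ᵐ t : ℝ, ∀ᵐ v ∂μ, f (x₀ + t • v) ≠ 0 :=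
    (Measure.ae_ae_comm hmeas).1 (.of_forall hline)
  obtain ⟨t, ht, ht0⟩ := (hswap.and (Measure.ae_ne volume (0 : ℝ))).exists
  have h₁ := (measurePreserving_add_left μ (-x₀)).quasiMeasurePreserving
  have h₂ := Measure.quasiMeasurePreserving_smul μ (inv_ne_zero ht0)
  filter_upwards [(h₂.comp h₁).ae ht] with x hx
  simpa [smul_smul, mul_inv_cancel₀ ht0] using hx

instance isAddHaarMeasure_volume_fun {ι G : Type*} [Fintype ι] [NormedAddCommGroup G]
    [NormedSpace ℝ G] [FiniteDimensional ℝ G] [MeasureSpace G] [BorelSpace G]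
    [(volume : Measure G).IsAddHaarMeasure] :
    (volume : Measure (ι → G)).IsAddHaarMeasure :=
  have := FiniteDimensional.proper ℝ G
  Measure.pi.isAddHaarMeasure _

instance isAddHaarMeasure_volume_prod {G H : Type*} [NormedAddCommGroup G]
    [NormedSpace ℝ G] [FiniteDimensional ℝ G] [MeasureSpace G] [BorelSpace G]
    [(volume : Measure G).IsAddHaarMeasure] [NormedAddCommGroup H]
    [NormedSpace ℝ H] [FiniteDimensional ℝ H] [MeasureSpace H] [BorelSpace H]
    [(volume : Measure H).IsAddHaarMeasure] :
    (volume : Measure (G × H)).IsAddHaarMeasure :=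
  have := FiniteDimensional.proper ℝ G
  have := FiniteDimensional.proper ℝ H
  Measure.prod.instIsAddHaarMeasure _ _

section Analytic

variable {𝕜 E l m n : Type*} [NontriviallyNormedField 𝕜] [NormedAddCommGroup E] [NormedSpace 𝕜 E]
  {s : Set E}

theorem Matrix.analyticOnNhd_of_apply [Fintype m] [Fintype n] {f : E → m → n → 𝕜}
    (hf : AnalyticOnNhd 𝕜 f s) (i : m) (j : n) :
    AnalyticOnNhd 𝕜 (fun x => of (f x) i j) s :=
  fun x hx => analyticAt_pi_iff.1 (analyticAt_pi_iff.1 (hf x hx) i) j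

theorem Matrix.analyticOnNhd_mul [Fintype m] {A : E → Matrix l m 𝕜} {B : E → Matrix m n 𝕜}
    (hA : ∀ i j, AnalyticOnNhd 𝕜 (fun x => A x i j) s)
    (hB : ∀ i j, AnalyticOnNhd 𝕜 (fun x => B x i j) s) (i : l) (j : n) :
    AnalyticOnNhd 𝕜 (fun x => (A x * B x) i j) s := by
  simp only [mul_apply]
  exact Finset.analyticOnNhd_fun_sum _ fun k _ => (hA i k).mul (hB k j)

theorem Matrix.analyticOnNhd_list_prod_ofFn [Fintype n] [DecidableEq n] {r : ℕ}
    {A : E → Fin r → Matrix n n 𝕜}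
    (hA : ∀ t i j, AnalyticOnNhd 𝕜 (fun x => A x t i j) s) (i j : n) :
    AnalyticOnNhd 𝕜 (fun x => (List.ofFn (A x)).prod i j) s := by
  induction r generalizing i j with
  | zero => simpa using analyticOnNhd_const
  | succ r ih =>
    simp only [List.ofFn_succ, List.prod_cons]
    exact analyticOnNhd_mul (hA 0) (ih fun t => hA t.succ) i j

theorem Matrix.analyticOnNhd_det [Fintype n] [DecidableEq n] {A : E → Matrix n n 𝕜}
    (hA : ∀ i j, AnalyticOnNhd 𝕜 (fun x => A x i j) s) :
    AnalyticOnNhd 𝕜 (fun x => (A x).det) s := by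
  simp only [det_apply']
  exact Finset.analyticOnNhd_fun_sum _ fun σ _ =>
    analyticOnNhd_const.mul (Finset.analyticOnNhd_fun_prod _ fun i _ => hA (σ i) i)

end Analytic

theorem kr_divNat_modNat {α : Type*} [NonAssocSemiring α] (n m : ℕ) :
    kr (of fun (i : Fin n) (c : Fin (n * m)) => if i = c.divNat then (1 : α) else 0)
      (of fun (j : Fin m) (c : Fin (n * m)) => if j = c.modNat then (1 : α) else 0) = 1 := by
  ext r c
  have h : r = c ↔ r.divNat = c.divNat ∧ r.modNat = c.modNat := by
    rw [← finProdFinEquiv.symm.injective.eq_iff]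
    exact Prod.ext_iff
  simp only [kr, of_apply, one_apply, h, ite_and, mul_ite, mul_one, mul_zero]
  split_ifs <;> rfl

/-- The space of tuples `(U, V, W, P)`. -/
abbrev ParameterSpace (d k r : ℕ) : Type :=
  (Fin d → Fin (d * k) → ℝ) × (Fin r → Fin (d * k) → Fin (d * k) → ℝ) ×
    (Fin (d * k) → Fin (d * k) → ℝ) × (Fin (d * k) → Fin k → ℝ)

set_option synthInstance.maxHeartbeats 200000 in
set_option synthInstance.maxSize 2000 in
instance (d k r : ℕ) : (volume : Measure (ParameterSpace d k r)).IsAddHaarMeasure :=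
  inferInstance

/-- Fix diagonal matrices `Δ_1, …, Δ_r ∈ ℝ^{dk×dk}` with nonzero diagonal
entries. For Lebesgue-almost every tuple `(U, V_1, …, V_r, W, P)`, the `dk×dk` matrix
`(U Δ_1 V_1 Δ_2 V_2 ⋯ Δ_r V_r) ⊛ (Pᵀ Wᵀ)` is invertible. -/
theorem khatri_rao_with_diagonal_chain_ae_invertible (d k r : ℕ)
    (hd : 1 ≤ d) (hk : 1 ≤ k) (hr : 1 ≤ r)
    (Δ : Fin r → Matrix (Fin (d * k)) (Fin (d * k)) ℝ)
    (hΔoff : ∀ t i j, i ≠ j → Δ t i j = 0) (hΔdiag : ∀ t i, Δ t i i ≠ 0) :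
    ∀ᵐ T : (Fin d → Fin (d * k) → ℝ) × (Fin r → (Fin (d * k) → Fin (d * k) → ℝ)) ×
           (Fin (d * k) → Fin (d * k) → ℝ) × (Fin (d * k) → Fin k → ℝ) ∂volume,
      IsUnit (kr (of T.1 * (List.ofFn fun t : Fin r => Δ t * of (T.2.1 t)).prod)
                 ((of T.2.2.2)ᵀ * (of T.2.2.1)ᵀ)) := by
  let M := fun T : ParameterSpace d k r =>
    kr (of T.1 * (List.ofFn fun t : Fin r => Δ t * of (T.2.1 t)).prod)
      ((of T.2.2.2)ᵀ * (of T.2.2.1)ᵀ)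
  have hf : AnalyticOnNhd ℝ (fun T => (M T).det) Set.univ := by
    refine analyticOnNhd_det fun i j => ?_
    have hU := analyticOnNhd_of_apply (f := fun T : ParameterSpace d k r => T.1) (s := Set.univ)
      fun _ _ => analyticAt_fst (𝕜 := ℝ)
    have hV (t) := analyticOnNhd_of_apply (f := fun T : ParameterSpace d k r => T.2.1 t)
      (s := Set.univ) fun _ _ => analyticAt_pi_iff.1 (analyticAt_fst.fun_comp (analyticAt_snd (𝕜 := ℝ))) t
    have hW (a b) := analyticOnNhd_of_apply (f := fun T : ParameterSpace d k r => T.2.2.1)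
      (s := Set.univ)
      (fun _ _ => analyticAt_fst.fun_comp (analyticAt_snd.fun_comp (analyticAt_snd (𝕜 := ℝ)))) b a
    have hP (a b) := analyticOnNhd_of_apply (f := fun T : ParameterSpace d k r => T.2.2.2)
      (s := Set.univ)
      (fun _ _ => analyticAt_snd.fun_comp (analyticAt_snd.fun_comp (analyticAt_snd (𝕜 := ℝ)))) b a
    have hprod := analyticOnNhd_list_prod_ofFn
      (A := fun (T : ParameterSpace d k r) t => Δ t * of (T.2.1 t))
      fun t => analyticOnNhd_mul (fun _ _ => analyticOnNhd_const) (hV t)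
    exact (analyticOnNhd_mul hU hprod _ _).mul (analyticOnNhd_mul hP hW _ _)
  let T₀ : ParameterSpace d k r :=
    (fun i c => if i = c.divNat then 1 else 0, fun t => ((Δ t)⁻¹ : Matrix _ _ ℝ),
      (1 : Matrix (Fin (d * k)) (Fin (d * k)) ℝ), fun c j => if j = c.modNat then 1 else 0)
  have hΔ (t : Fin r) : Δ t * (Δ t)⁻¹ = 1 := by
    refine mul_nonsing_inv _ (isUnit_iff_ne_zero.2 ?_)
    rw [← (show (Δ t).IsDiag from fun i j => hΔoff t i j).diagonal_diag, det_diagonal]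
    exact Finset.prod_ne_zero_iff.2 fun i _ => hΔdiag t i
  have hT₀ : M T₀ = 1 := by
    have hprod : (List.ofFn fun t : Fin r => Δ t * of (T₀.2.1 t)).prod = 1 := by
      refine List.prod_eq_one fun A hA => ?_
      obtain ⟨t, ht⟩ := (List.mem_ofFn' _ _).1 hA
      exact ht ▸ hΔ t
    have hW : (of T₀.2.2.1)ᵀ = 1 := transpose_one
    simp only [M, hprod, hW, Matrix.mul_one]
    exact kr_divNat_modNat d k
  have := hf.ae_ne_zero volume (x₀ := T₀) (by simp [hT₀])
  filter_upwards [this] with T hT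
  exact (isUnit_iff_isUnit_det _).2 (isUnit_iff_ne_zero.2 hT)
end
end
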